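/- arXiv:2201.08915 — 3 statements merged into one kernel-verified Lean document; each statement's English description precedes it below -/
import Mathlib

section
/- In any alternative ring, (a,b,c)∘[a,b] = 0 and (a, b, c∘[a,b]) = 0, where [a,b] = ab - ba, a∘b = ab + ba, and (x,y,z) = (xy)z - x(yz). -/
variable {A : Type*} [NonUnitalNonAssocRing A]

/-- Commutator `[x,y] = xy - yx`. -/
def altComm (x y : A) : A := x * y - y * x

/-- Associator `(x,y,z) = (xy)z - x(yz)`. -/
def altAssoc (x y z : A) : A := (x * y) * z - x * (y * z)

/-- Jordan product `x ∘ y = xy + yx`. -/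
def altSop (x y : A) : A := x * y + y * x

/-- Jacobian `J(a,b,c) = [[a,b],c] + [[b,c],a] + [[c,a],b]`. -/
def altJac (x y z : A) : A := altComm (altComm x y) z + altComm (altComm y z) x + altComm (altComm z x) y

/-- `D(a,b,c) = (a∘b)∘c - (a∘c)∘b`. -/
def altDop (x y z : A) : A := altSop (altSop x y) z - altSop (altSop x z) y

namespace AltAux

/-- The Kleinfeld function. -/
def kf (w x y z : A) : A :=
  altAssoc (w * x) y z - x * altAssoc w y z - altAssoc x y z * w

theorem teich (w x y z : A) :
    altAssoc (w * x) y z - altAssoc w (x * y) z + altAssoc w x (y * z)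
      - w * altAssoc x y z - altAssoc w x y * z = 0 := by
  simp only [altAssoc, mul_sub, sub_mul]; abel

theorem skew12 (hl : ∀ x y : A, altAssoc x x y = 0) (x y z : A) :
    altAssoc x y z = - altAssoc y x z := by
  have h := hl (x + y) z
  have h1 := hl x z
  have h2 := hl y z
  have e : altAssoc (x + y) (x + y) z
      = altAssoc x x z + altAssoc y y z + (altAssoc x y z + altAssoc y x z) := by
    simp only [altAssoc, mul_add, add_mul]; abel
  rw [e, h1, h2, zero_add, zero_add] at h
  exact eq_neg_of_add_eq_zero_left h

theorem skew23 (hr : ∀ x y : A, altAssoc y x x = 0) (x y z : A) :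
    altAssoc x y z = - altAssoc x z y := by
  have h := hr (y + z) x
  have h1 := hr y x
  have h2 := hr z x
  have e : altAssoc x (y + z) (y + z)
      = altAssoc x y y + altAssoc x z z + (altAssoc x y z + altAssoc x z y) := by
    simp only [altAssoc, mul_add, add_mul]; abel
  rw [e, h1, h2, zero_add, zero_add] at h
  exact eq_neg_of_add_eq_zero_left h

theorem rot (hl : ∀ x y : A, altAssoc x x y = 0) (hr : ∀ x y : A, altAssoc y x x = 0)
    (x y z : A) : altAssoc x y z = altAssoc y z x := by
  rw [skew12 hl x y z, skew23 hr y x z, neg_neg]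

theorem kf_cyc (hl : ∀ x y : A, altAssoc x x y = 0) (hr : ∀ x y : A, altAssoc y x x = 0)
    (w x y z : A) : kf w x y z = - kf z w x y := by
  have t1 := teich w x y z
  have t2 := teich x y z w
  rw [rot hl hr w (x * y) z, ← rot hl hr (y * z) w x] at t1
  rw [rot hl hr x (y * z) w, ← rot hl hr (z * w) x y] at t2
  unfold kf
  rw [rot hl hr w y z, rot hl hr z x y]
  linear_combination (norm := abel) t1 + t2

theorem kf34 (hr : ∀ x y : A, altAssoc y x x = 0)
    (w x y z : A) : kf w x y z = - kf w x z y := by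
  unfold kf
  rw [skew23 hr (w * x) y z, skew23 hr w y z, skew23 hr x y z]
  simp only [mul_neg, neg_mul]; abel

theorem kf_last (hr : ∀ x y : A, altAssoc y x x = 0) (w x y : A) : kf w x y y = 0 := by
  simp [kf, hr]

theorem kf12 (hl : ∀ x y : A, altAssoc x x y = 0) (hr : ∀ x y : A, altAssoc y x x = 0)
    (w x y z : A) : kf w x y z = - kf x w y z := by
  rw [kf_cyc hl hr w x y z, kf_cyc hl hr z w x y, kf34 hr y z w x, kf_cyc hl hr x w y z,
    kf_cyc hl hr z x w y]

theorem kf_rot (hl : ∀ x y : A, altAssoc x x y = 0) (hr : ∀ x y : A, altAssoc y x x = 0)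
    (w x y z : A) : kf w x y z = kf w z x y := by
  rw [kf_cyc hl hr w x y z, kf12 hl hr z w x y, neg_neg]

/-- `(x, x y, z) = (x, y, z) x`. -/
theorem mulR (hl : ∀ x y : A, altAssoc x x y = 0) (hr : ∀ x y : A, altAssoc y x x = 0)
    (x y z : A) : altAssoc x (x * y) z = altAssoc x y z * x := by
  have h : kf x y x z = 0 := by
    rw [kf34 hr x y x z, kf_cyc hl hr x y z x, kf_cyc hl hr x x y z, kf_cyc hl hr z x x y,
      kf_last hr]
    simp
  have h' : altAssoc x x z = 0 := hl x z
  unfold kf at h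
  rw [h', mul_zero, skew12 hl (x * y) x z, skew12 hl y x z, neg_mul] at h
  linear_combination (norm := abel) - h

/-- `(x, y x, z) = x (x, y, z)`. -/
theorem mulL (hl : ∀ x y : A, altAssoc x x y = 0) (hr : ∀ x y : A, altAssoc y x x = 0)
    (x y z : A) : altAssoc x (y * x) z = x * altAssoc x y z := by
  have h : kf y x x z = 0 := by
    rw [kf_cyc hl hr, kf_last hr, neg_zero]
  have h' : altAssoc x x z = 0 := hl x z
  unfold kf at h
  rw [h', zero_mul, skew12 hl (y * x) x z, skew12 hl y x z, mul_neg] at h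
  linear_combination (norm := abel) - h

/-- `F(ab,c,a,b) = (b,f,a)` with `f = (a,b,c)`. -/
theorem kf_ab (hl : ∀ x y : A, altAssoc x x y = 0) (hr : ∀ x y : A, altAssoc y x x = 0)
    (a b c : A) : kf (a * b) a b c = altAssoc b (altAssoc a b c) a := by
  have h : kf (a * b) a b c = kf a b (a * b) c := by
    rw [kf_rot hl hr (a * b) a b c, kf_cyc hl hr (a * b) c a b, kf_cyc hl hr b (a * b) c a,
      neg_neg]
  rw [h]
  unfold kf
  rw [hl, mulR hl hr, mulL hl hr, skew12 hl b a c]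
  generalize altAssoc a b c = f
  simp only [altAssoc, mul_neg, neg_mul]
  abel

theorem kf_ba (hl : ∀ x y : A, altAssoc x x y = 0) (hr : ∀ x y : A, altAssoc y x x = 0)
    (a b c : A) : kf (b * a) a b c = altAssoc a (altAssoc a b c) b := by
  have h := kf_ab hl hr b a c
  have h2 : kf (b * a) a b c = - kf (b * a) b a c := by
    rw [kf_rot hl hr (b * a) b a c, kf34 hr (b * a) c b a, neg_neg, kf_rot hl hr (b * a) a b c]
  rw [h2, h, skew12 hl b a c]
  simp only [altAssoc, mul_sub, sub_mul, mul_neg, neg_mul]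
  abel

theorem first (hl : ∀ x y : A, altAssoc x x y = 0) (hr : ∀ x y : A, altAssoc y x x = 0)
    (a b c : A) : altSop (altAssoc a b c) (altComm a b) = 0 := by
  have h1 := kf_ab hl hr a b c
  have h2 := kf_ba hl hr a b c
  rw [kf12 hl hr] at h2
  unfold kf at h1 h2
  have e : a * b * a = a * (b * a) := sub_eq_zero.mp (by
    have := skew23 hr a b a
    rw [hl, neg_zero] at this; exact this)
  have p1 : altAssoc (a * b) b c = b * altAssoc a b c := by
    rw [skew12 hl, mulL hl hr, skew12 hl b a c, mul_neg, neg_neg]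
  have p2 : altAssoc (b * a) b c = altAssoc a b c * b := by
    rw [skew12 hl, mulR hl hr, skew12 hl b a c, neg_mul, neg_neg]
  rw [e, p1] at h1
  rw [p2] at h2
  generalize altAssoc a b c = f at *
  have q1 := skew12 hl f a b
  have q2 := skew23 hr f a b
  have q3 := skew12 hl f b a
  have q4 := skew23 hr a f b
  have q5 := skew23 hr b f a
  generalize altAssoc (a * (b * a)) b c = m at *
  simp only [altSop, altComm, altAssoc, mul_sub, sub_mul] at *
  grind

theorem second (hl : ∀ x y : A, altAssoc x x y = 0) (hr : ∀ x y : A, altAssoc y x x = 0)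
    (a b c : A) : altAssoc a b (altSop c (altComm a b)) = 0 := by
  have k1 := kf12 hl hr c (altComm a b) a b
  have h0 := first hl hr a b c
  have z1 : altAssoc (altComm a b) a b = 0 := by
    have x1 := mulL hl hr b a a
    have x2 := mulR hl hr a b b
    have e : altAssoc (altComm a b) a b = altAssoc (a * b) a b - altAssoc (b * a) a b := by
      simp only [altAssoc, altComm, mul_sub, sub_mul]; abel
    rw [e, skew12 hl (a * b) a b, x2, ← rot hl hr b (b * a) a, mulR hl hr, hr, skew23 hr b a a, hr]
    simp
  have e2 : altAssoc a b (altSop c (altComm a b))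
      = altAssoc (c * altComm a b) a b + altAssoc (altComm a b * c) a b := by
    rw [rot hl hr (c * altComm a b) a b, rot hl hr (altComm a b * c) a b]
    simp only [altAssoc, altSop, mul_add]; abel
  unfold kf at k1
  rw [z1, rot hl hr c a b] at k1
  rw [e2]
  unfold altSop at h0
  simp only [mul_zero, zero_mul] at k1
  linear_combination (norm := abel) k1 + h0

end AltAux

theorem stmt_5
    (alt_left : ∀ x y : A, altAssoc x x y = 0)
    (alt_right : ∀ x y : A, altAssoc y x x = 0)
    (a b c : A) :
    altSop (altAssoc a b c) (altComm a b) = 0 ∧ altAssoc a b (altSop c (altComm a b)) = 0 :=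
  ⟨AltAux.first alt_left alt_right a b c, AltAux.second alt_left alt_right a b c⟩
end

section
/- In any alternative ring, ([a,b]^2, b, c) = 0, where [a,b] = ab - ba and (x,y,z) = (xy)z - x(yz). -/
variable {A : Type*} [NonUnitalNonAssocRing A]

/-- Facts on associators in an alternative ring, in the form used below. -/
theorem assoc_teich (w x y z : A) :
    altAssoc (w * x) y z - altAssoc w (x * y) z + altAssoc w x (y * z)
      = w * altAssoc x y z + altAssoc w x y * z := by
  simp only [altAssoc, mul_sub, sub_mul]; abel

theorem assoc_add1 (x x' y z : A) :
    altAssoc (x + x') y z = altAssoc x y z + altAssoc x' y z := by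
  simp only [altAssoc, mul_add, add_mul]; abel

theorem assoc_add2 (x y y' z : A) :
    altAssoc x (y + y') z = altAssoc x y z + altAssoc x y' z := by
  simp only [altAssoc, mul_add, add_mul]; abel

theorem assoc_add3 (x y z z' : A) :
    altAssoc x y (z + z') = altAssoc x y z + altAssoc x y z' := by
  simp only [altAssoc, mul_add, add_mul]; abel

theorem assoc_sub1 (x x' y z : A) :
    altAssoc (x - x') y z = altAssoc x y z - altAssoc x' y z := by
  simp only [altAssoc, mul_sub, sub_mul]; abel


theorem assoc_sw12 (hl : ∀ x y : A, altAssoc x x y = 0)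
    (x y z : A) : altAssoc x y z = - altAssoc y x z := by
  have h := hl (x + y) z
  rw [assoc_add1, assoc_add2, assoc_add2, hl, hl, zero_add, add_zero] at h
  rw [eq_neg_iff_add_eq_zero, ← h]

theorem assoc_sw23 (hr : ∀ x y : A, altAssoc y x x = 0)
    (x y z : A) : altAssoc x y z = - altAssoc x z y := by
  have h := hr (y + z) x
  rw [assoc_add3, assoc_add2, assoc_add2, hr, hr, zero_add, add_zero] at h
  rw [eq_neg_iff_add_eq_zero, ← h]; abel

theorem assoc_cyc (hl : ∀ x y : A, altAssoc x x y = 0) (hr : ∀ x y : A, altAssoc y x x = 0)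
    (x y z : A) : altAssoc x y z = altAssoc y z x := by
  rw [assoc_sw12 hl x y z, assoc_sw23 hr y x z, neg_neg]

/-- Middle step: `(x, xa, y) = (x, a, xy)`. -/
theorem assoc_mid (hl : ∀ x y : A, altAssoc x x y = 0) (hr : ∀ x y : A, altAssoc y x x = 0)
    (x a y : A) : altAssoc x (x * a) y = altAssoc x a (x * y) := by
  have h1 : altAssoc x (x * a) y + altAssoc x (x * y) a = 0 := by
    have e1 := assoc_teich x x a y
    have e2 := assoc_teich x x y a
    have e3 := assoc_sw23 hr (x * x) a y
    have e4 := assoc_sw23 hr x a y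
    simp only [hl, zero_mul, add_zero] at e1 e2
    rw [e3, e4, mul_neg] at e1
    grind
  rw [assoc_sw23 hr x a (x * y)]
  exact eq_neg_of_add_eq_zero_left h1

/-- `(x, ax, y) = x (x, a, y)`. -/
theorem assoc_moufL (hl : ∀ x y : A, altAssoc x x y = 0) (hr : ∀ x y : A, altAssoc y x x = 0)
    (x a y : A) : altAssoc x (a * x) y = x * altAssoc x a y := by
  have e := assoc_teich x a x y
  have f := assoc_sw12 hl (x * a) x y
  have g := assoc_mid hl hr x a y
  have k : altAssoc x a x = 0 := by rw [assoc_sw23 hr, hl, neg_zero]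
  rw [k, zero_mul, add_zero, f, g, assoc_sw12 hl a x y, mul_neg] at e
  grind

/-- `(x, xa, y) = (x, a, y) x`. -/
theorem assoc_moufR (hl : ∀ x y : A, altAssoc x x y = 0) (hr : ∀ x y : A, altAssoc y x x = 0)
    (x a y : A) : altAssoc x (x * a) y = altAssoc x a y * x := by
  have e := assoc_teich x a y x
  have k : altAssoc x (a * y) x = 0 := by rw [assoc_sw23 hr, hl, neg_zero]
  rw [k, assoc_sw23 hr x a (y * x), assoc_moufL hl hr, assoc_sw23 hr x y a, mul_neg,
    ← assoc_cyc hl hr x a y, ← assoc_cyc hl hr x (x * a) y] at e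
  grind

theorem assoc_sq (hl : ∀ x y : A, altAssoc x x y = 0) (hr : ∀ x y : A, altAssoc y x x = 0)
    (x a y : A) :
    altAssoc (x * x) a y = x * altAssoc x a y + altAssoc x a y * x := by
  have e := assoc_teich x x a y
  rw [hl, hl, zero_mul, assoc_moufR hl hr] at e
  grind

theorem assoc_jordan (hl : ∀ x y : A, altAssoc x x y = 0) (hr : ∀ x y : A, altAssoc y x x = 0)
    (x z a y : A) :
    altAssoc (x * z + z * x) a y =
      x * altAssoc z a y + altAssoc z a y * x + (z * altAssoc x a y + altAssoc x a y * z) := by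
  have e := assoc_sq hl hr (x + z) a y
  simp only [mul_add, add_mul, assoc_add1, assoc_sq hl hr] at e
  rw [assoc_add1]
  grind

/-- `[a,b] ∘ (a,b,c) = 0`. -/
theorem comm_jordan_assoc (hl : ∀ x y : A, altAssoc x x y = 0) (hr : ∀ x y : A, altAssoc y x x = 0)
    (a b c : A) :
    altComm a b * altAssoc a b c + altAssoc a b c * altComm a b = 0 := by
  have e := assoc_jordan hl hr c (a * b) a b
  have k : altAssoc (a * b) a b = 0 := by
    rw [assoc_sw12 hl, assoc_moufR hl hr, hr, zero_mul, neg_zero]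
  have s : c * (a * b) + a * b * c = (c * a) * b + a * (b * c) := by
    have := assoc_cyc hl hr c a b
    simp only [altAssoc] at this
    grind
  -- `((ca)b, a, b) = b(aw)`
  have p : altAssoc (c * a * b) a b = b * (a * altAssoc a b c) := by
    rw [← assoc_cyc hl hr b, assoc_moufL hl hr, assoc_cyc hl hr b, assoc_cyc hl hr _ a b,
      assoc_sw23 hr a b, assoc_moufL hl hr, ← mul_neg, ← assoc_sw23 hr]
  -- `(a(bc), a, b) = (wb)a`
  have q : altAssoc (a * (b * c)) a b = altAssoc a b c * b * a := by
    rw [assoc_sw12 hl, assoc_moufR hl hr, ← neg_mul, ← assoc_sw23 hr, assoc_cyc hl hr a b,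
      assoc_moufR hl hr, assoc_cyc hl hr a b]
  rw [s, assoc_add1, p, q, k, ← assoc_cyc hl hr b, ← assoc_cyc hl hr a] at e
  simp only [mul_zero, zero_mul, zero_add] at e
  generalize altAssoc a b c = w at *
  have u1 := assoc_cyc hl hr w a b
  have u2 := assoc_cyc hl hr w b a
  have u3 := assoc_sw12 hl b a w
  simp only [altAssoc] at u1 u2 u3
  simp only [altComm, mul_sub, sub_mul]
  grind

theorem stmt_6
    (alt_left : ∀ x y : A, altAssoc x x y = 0)
    (alt_right : ∀ x y : A, altAssoc y x x = 0)
    (a b c : A) :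
    altAssoc (altComm a b * altComm a b) b c = 0 := by
  have hl := alt_left
  have hr := alt_right
  have h1 := comm_jordan_assoc hl hr a b (c * b)
  have h2 := comm_jordan_assoc hl hr a b (b * c)
  rw [assoc_cyc hl hr a b, assoc_moufL hl hr, ← assoc_cyc hl hr a] at h1
  rw [assoc_cyc hl hr a b, assoc_moufR hl hr, ← assoc_cyc hl hr a] at h2
  have h3 : altAssoc (altComm a b) b c = b * altAssoc a b c - altAssoc a b c * b := by
    rw [altComm, assoc_sub1, assoc_sw12 hl (a * b), assoc_sw12 hl (b * a), assoc_moufL hl hr,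
      assoc_moufR hl hr, assoc_sw12 hl b a c, mul_neg, neg_mul, neg_neg, neg_neg]
  rw [assoc_sq hl hr, h3, mul_sub, sub_mul]
  grind
end

section
/- In any alternative ring, ([[a,b]^2, b], c, d) = 0, where [a,b] = ab - ba and (x,y,z) = (xy)z - x(yz). -/
variable {A : Type*} [NonUnitalNonAssocRing A]

/-- Kleinfeld function. -/
def kf (w x y z : A) : A := altAssoc (w * x) y z - x * altAssoc w y z - altAssoc x y z * w

theorem sw12 (alt_left : ∀ x y : A, altAssoc x x y = 0) (x y z : A) :
    altAssoc x y z = -altAssoc y x z := by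
  have h := alt_left (x + y) z
  have h1 := alt_left x z
  have h2 := alt_left y z
  have : altAssoc (x + y) (x + y) z = altAssoc x x z + altAssoc y y z
      + (altAssoc x y z + altAssoc y x z) := by
    simp only [altAssoc, mul_add, add_mul]; abel
  rw [this, h1, h2, zero_add, zero_add] at h
  exact eq_neg_of_add_eq_zero_left h

theorem sw23 (alt_right : ∀ x y : A, altAssoc y x x = 0) (x y z : A) :
    altAssoc x y z = -altAssoc x z y := by
  have h := alt_right (y + z) x
  have h1 := alt_right y x
  have h2 := alt_right z x
  have : altAssoc x (y + z) (y + z) = altAssoc x y y + altAssoc x z z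
      + (altAssoc x y z + altAssoc x z y) := by
    simp only [altAssoc, mul_add, add_mul]; abel
  rw [this, h1, h2, zero_add, zero_add] at h
  exact eq_neg_of_add_eq_zero_left h

theorem cyc (alt_left : ∀ x y : A, altAssoc x x y = 0)
    (alt_right : ∀ x y : A, altAssoc y x x = 0) (x y z : A) :
    altAssoc x y z = altAssoc y z x := by
  rw [sw12 alt_left x y z, sw23 alt_right y x z, neg_neg]

/-- The cyclic sum of commutators with associators. -/
def kg (w x y z : A) : A :=
  altComm w (altAssoc x y z) - altComm x (altAssoc y z w) + altComm y (altAssoc z w x)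
    - altComm z (altAssoc w x y)

theorem kf_sum (alt_left : ∀ x y : A, altAssoc x x y = 0)
    (alt_right : ∀ x y : A, altAssoc y x x = 0) (w x y z : A) :
    kf w x y z - kf x y z w + kf y z w x = kg w x y z := by
  have c := cyc alt_left alt_right
  have t : altAssoc (w * x) y z - altAssoc w (x * y) z + altAssoc w x (y * z)
      = w * altAssoc x y z + altAssoc w x y * z := by
    simp only [altAssoc, mul_sub, sub_mul]; abel
  rw [c w (x * y) z, ← c (y * z) w x] at t
  have t' : altAssoc (w * x) y z = w * altAssoc x y z + altAssoc w x y * z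
      + altAssoc (x * y) z w - altAssoc (y * z) w x := by
    rw [← t]; abel
  simp only [kf, kg, altComm]
  rw [t', c w y z, c x z w, c z w x, c y w x]
  abel

theorem kf_cyc (alt_left : ∀ x y : A, altAssoc x x y = 0)
    (alt_right : ∀ x y : A, altAssoc y x x = 0) (w x y z : A) :
    kf w x y z = -kf z w x y := by
  have h1 := kf_sum alt_left alt_right w x y z
  have h2 := kf_sum alt_left alt_right x y z w
  have h3 : kg w x y z + kg x y z w = 0 := by simp only [kg]; abel
  rw [← h1, ← h2] at h3
  apply eq_neg_of_add_eq_zero_left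
  rw [← h3]; abel

theorem kf_34 (alt_right : ∀ x y : A, altAssoc y x x = 0) (w x y z : A) :
    kf w x y z = -kf w x z y := by
  simp only [kf]
  rw [sw23 alt_right (w * x) y z, sw23 alt_right w y z, sw23 alt_right x y z, mul_neg, neg_mul]
  abel

theorem kf_23 (alt_left : ∀ x y : A, altAssoc x x y = 0)
    (alt_right : ∀ x y : A, altAssoc y x x = 0) (w x y z : A) :
    kf w x y z = -kf w y x z := by
  have k := kf_cyc alt_left alt_right
  rw [k w x y z, kf_34 alt_right z w x y, k w y x z]

theorem kf_12 (alt_left : ∀ x y : A, altAssoc x x y = 0)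
    (alt_right : ∀ x y : A, altAssoc y x x = 0) (w x y z : A) :
    kf w x y z = -kf x w y z := by
  have k := kf_cyc alt_left alt_right
  rw [k w x y z, kf_23 alt_left alt_right z w x y, k x w y z]

theorem kf_zero34 (alt_right : ∀ x y : A, altAssoc y x x = 0) (w x y : A) :
    kf w x y y = 0 := by
  simp only [kf, alt_right]; simp

theorem kf_comm (alt_left : ∀ x y : A, altAssoc x x y = 0)
    (alt_right : ∀ x y : A, altAssoc y x x = 0) (w x y z : A) :
    kf w x y z = altAssoc (altComm w x) y z + altAssoc (altComm y z) w x := by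
  have c := cyc alt_left alt_right
  have k := kf_cyc alt_left alt_right
  have k34 := kf_34 alt_right
  have g := kf_sum alt_left alt_right w x y z
  have e1 : kf x y z w = -kf w x y z := by rw [k x y z w]
  have e2 : kf y z w x = kf w x y z := by rw [k y z w x, e1, neg_neg]
  have e3 : kf x w y z = -kf w x y z := kf_12 alt_left alt_right x w y z
  have e4 : kf z y w x = -kf w x y z := by rw [kf_12 alt_left alt_right z y w x, e2]
  rw [e1, e2] at g
  have s1 : altAssoc (altComm w x) y z = kf w x y z - kf x w y z
      + altComm x (altAssoc w y z) - altComm w (altAssoc x y z) := by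
    simp only [kf, altComm, altAssoc, sub_mul, mul_sub]; abel
  have s2 : altAssoc (altComm y z) w x = kf y z w x - kf z y w x
      + altComm z (altAssoc y w x) - altComm y (altAssoc z w x) := by
    simp only [kf, altComm, altAssoc, sub_mul, mul_sub]; abel
  rw [s1, s2, e2, e3, e4, c w y z, c y w x]
  have g' : altComm w (altAssoc x y z) = kf w x y z - -kf w x y z + kf w x y z
     + altComm x (altAssoc y z w) - altComm y (altAssoc z w x) + altComm z (altAssoc w x y) := by
    rw [g, kg]; abel
  rw [g']; abel

theorem mf1 (alt_left : ∀ x y : A, altAssoc x x y = 0)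
    (alt_right : ∀ x y : A, altAssoc y x x = 0) (a z x : A) :
    altAssoc (a * z) a x = altAssoc z a x * a := by
  have k := kf_cyc alt_left alt_right
  have h : kf a z a x = 0 := by
    rw [k a z a x, kf_34 alt_right x a z a, k x a a z, kf_zero34 alt_right]; simp
  simp only [kf, alt_left, mul_zero, sub_zero] at h
  exact sub_eq_zero.1 h

theorem mf2 (alt_left : ∀ x y : A, altAssoc x x y = 0)
    (alt_right : ∀ x y : A, altAssoc y x x = 0) (b z x : A) :
    altAssoc (z * b) b x = b * altAssoc z b x := by
  have k := kf_cyc alt_left alt_right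
  have h : kf z b b x = 0 := by
    rw [k z b b x, kf_zero34 alt_right]; simp
  simp only [kf, alt_left, zero_mul, sub_zero] at h
  exact sub_eq_zero.1 h

theorem msq (alt_left : ∀ x y : A, altAssoc x x y = 0)
    (alt_right : ∀ x y : A, altAssoc y x x = 0) (v y x : A) :
    altAssoc (v * v) y x = v * altAssoc v y x + altAssoc v y x * v := by
  have k := kf_cyc alt_left alt_right
  have h : kf v v y x = 0 := by
    rw [k v v y x, k x v v y, kf_zero34 alt_right]; simp
  simp only [kf, sub_sub] at h
  exact sub_eq_zero.1 h

theorem jordan_zero (alt_left : ∀ x y : A, altAssoc x x y = 0)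
    (alt_right : ∀ x y : A, altAssoc y x x = 0) (a b x : A) :
    altComm a b * altAssoc a b x + altAssoc a b x * altComm a b = 0 := by
  have k := kf_cyc alt_left alt_right
  have c := cyc alt_left alt_right
  have h : kf (a * b) b a x = kf a (a * b) b x := by
    rw [kf_23 alt_left alt_right (a * b) b a x, kf_12 alt_left alt_right (a * b) a b x, neg_neg]
  have e1 : altAssoc (a * b * b) a x = -((b * altAssoc a b x + altAssoc a b x * b) * a) := by
    have : a * b * b = a * (b * b) := sub_eq_zero.1 (alt_right b a)
    rw [this, mf1 alt_left alt_right, msq alt_left alt_right, sw12 alt_left b a x]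
    simp only [mul_neg, neg_mul, add_mul]; abel
  have e2 : altAssoc (a * (a * b)) b x = b * (a * altAssoc a b x + altAssoc a b x * a) := by
    have : a * (a * b) = a * a * b := (sub_eq_zero.1 (alt_left a b)).symm
    rw [this, mf2 alt_left alt_right, msq alt_left alt_right]
  have e3 : altAssoc (a * b) a x = -(altAssoc a b x * a) := by
    rw [mf1 alt_left alt_right, sw12 alt_left b a x, neg_mul]
  have e4 := mf2 alt_left alt_right b a x
  simp only [kf] at h
  rw [e1, e2, e3, e4, sw12 alt_left b a x] at h
  generalize altAssoc a b x = p at *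
  have q : altAssoc p b a = altAssoc b a p := c p b a
  have q' := sub_eq_zero.2 q
  have h' := sub_eq_zero.2 h
  rw [← add_zero (0 : A)]
  nth_rewrite 1 [← h']
  rw [← q']
  simp only [altComm, altAssoc, mul_sub, sub_mul, mul_add, add_mul, mul_neg, neg_mul]
  abel

theorem key (alt_left : ∀ x y : A, altAssoc x x y = 0)
    (alt_right : ∀ x y : A, altAssoc y x x = 0) (a b x : A) :
    altAssoc (altComm a b * altComm a b) b x = 0 := by
  have E : ∀ s t : A, altAssoc (altComm s b) b t = altComm b (altAssoc s b t) := by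
    intro s t
    have h1 := mf1 alt_left alt_right b s t
    have h2 := mf2 alt_left alt_right b s t
    have : altAssoc (altComm s b) b t = altAssoc (s * b) b t - altAssoc (b * s) b t := by
      simp only [altComm, altAssoc, sub_mul]; abel
    rw [this, h1, h2, altComm, sw12 alt_left s b t]
  have q : altAssoc (altComm a b) b x = altAssoc a b (altComm x b) := by
    have c := cyc alt_left alt_right
    rw [c a b, c b, sw23 alt_right (altComm x b) a b, E, E, c a b x, c b x a,
      sw23 alt_right x a b]
    simp only [altComm, mul_neg, neg_mul]; abel
  rw [msq alt_left alt_right, q, jordan_zero alt_left alt_right]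

theorem stmt_7
    (alt_left : ∀ x y : A, altAssoc x x y = 0)
    (alt_right : ∀ x y : A, altAssoc y x x = 0)
    (a b c d : A) :
    altAssoc (altComm (altComm a b * altComm a b) b) c d = 0 := by
  have k := key alt_left alt_right a b
  generalize altComm a b * altComm a b = u at *
  have cy := cyc alt_left alt_right
  have k' : ∀ x, altAssoc x u b = 0 := fun x => by rw [cy, k]
  have h := kf_comm alt_left alt_right c d u b
  simp only [kf, k', mul_zero, zero_mul, sub_zero, zero_add] at h
  exact h.symm
end
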